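/- Let (A, ⦃-,-⦄) be a double Poisson algebra with a moment map w, let I = AwA be the two-sided ideal generated by w, and let B = A/I. Then: (a) m(⦃x,b⦄) ∈ I for every x ∈ A and every b ∈ I; (b) there is a unique Lie algebra structure on B/[B,B] such that the canonical surjection A/[A,A] → B/[B,B] is a morphism of Lie algebras, where A/[A,A] carries the Lie bracket induced by ⦃-,-⦄ (i.e. [π(x),π(y)] = π(m(⦃x,y⦄))); (c) for each b ∈ B, the adjoint action of the class of b on B/[B,B] is induced by a K-linear derivation of B. In particular, the noncommutative Hamiltonian reduction B carries an H₀-Poisson (NC Poisson) structure and the projection A/[A,A] → B/[B,B] is a Lie algebra morphism. -/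

import Mathlib

open TensorProduct

noncomputable section

universe u v w

/-- The cyclic permutation `ρ : A⊗A⊗A → A⊗A⊗A`, `(x⊗y)⊗z ↦ (z⊗x)⊗y`. -/
def cyc (K : Type u) [Field K] (A : Type v) [Ring A] [Algebra K A] :
    ((A ⊗[K] A) ⊗[K] A) →ₗ[K] ((A ⊗[K] A) ⊗[K] A) :=
  ((TensorProduct.assoc K A A A).symm.toLinearMap).comp
    ((TensorProduct.comm K (A ⊗[K] A) A).toLinearMap)

/-- A double bracket on the `K`-algebra `A`: a `K`-bilinear map `A × A → A ⊗ A` which is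
antisymmetric with respect to the flip and satisfies the Leibniz rule in its second
argument for the outer bimodule structure on `A ⊗ A`. -/
structure DoubleBracket (K : Type u) (A : Type v) [Field K] [Ring A] [Algebra K A] where
  br : A →ₗ[K] A →ₗ[K] A ⊗[K] A
  antisymm : ∀ x y : A, br y x = - (TensorProduct.comm K A A) (br x y)
  leibniz : ∀ x a b : A, br x (a * b)
      = (TensorProduct.map (LinearMap.mulLeft K a) (LinearMap.id : A →ₗ[K] A)) (br x b)
        + (TensorProduct.map (LinearMap.id : A →ₗ[K] A) (LinearMap.mulRight K b)) (br x a)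

/-- The double Jacobi identity: a double bracket is a double Poisson bracket iff it holds. -/
def DoubleBracket.IsPoisson {K : Type u} {A : Type v} [Field K] [Ring A] [Algebra K A]
    (D : DoubleBracket K A) : Prop :=
  ∀ x y z : A,
    (LinearMap.rTensor A (D.br x)) (D.br y z)
      + cyc K A ((LinearMap.rTensor A (D.br y)) (D.br z x))
      + cyc K A (cyc K A ((LinearMap.rTensor A (D.br z)) (D.br x y))) = 0

/-- The associated bracket `{x,y} = m(⦃x,y⦄)`. -/
def DoubleBracket.ab {K : Type u} {A : Type v} [Field K] [Ring A] [Algebra K A]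
    (D : DoubleBracket K A) (x y : A) : A :=
  LinearMap.mul' K A (D.br x y)

/-- `[A,A]`: the `K`-linear span of all commutators. -/
def commSpan (K : Type u) [Field K] (A : Type v) [Ring A] [Algebra K A] : Submodule K A :=
  Submodule.span K {z : A | ∃ u v : A, z = u * v - v * u}

/-- `K·1 + [A,A]`. -/
def natSub (K : Type u) [Field K] (A : Type v) [Ring A] [Algebra K A] : Submodule K A :=
  Submodule.span K {(1 : A)} ⊔ commSpan K A

/-- The two-sided ideal `AwA` generated by `w`, as a `K`-submodule of `A`. -/
def wIdeal (K : Type u) [Field K] {A : Type v} [Ring A] [Algebra K A] (w : A) : Submodule K A :=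
  Submodule.span K {z : A | ∃ a b : A, z = a * w * b}

theorem ab_mul {K : Type u} {A : Type v} [Field K] [Ring A] [Algebra K A]
    (D : DoubleBracket K A) (x a b : A) : D.ab x (a * b) = a * D.ab x b + D.ab x a * b := by
  have h1 : ∀ t : A ⊗[K] A, LinearMap.mul' K A
      ((TensorProduct.map (LinearMap.mulLeft K a) (LinearMap.id : A →ₗ[K] A)) t)
      = a * LinearMap.mul' K A t := by
    intro t
    induction t with
    | zero => simp
    | tmul u v => simp [mul_assoc]
    | add p q hp hq => simp only [map_add, hp, hq, mul_add]
  have h2 : ∀ t : A ⊗[K] A, LinearMap.mul' K A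
      ((TensorProduct.map (LinearMap.id : A →ₗ[K] A) (LinearMap.mulRight K b)) t)
      = LinearMap.mul' K A t * b := by
    intro t
    induction t with
    | zero => simp
    | tmul u v => simp [mul_assoc]
    | add p q hp hq => simp only [map_add, hp, hq, add_mul]
  unfold DoubleBracket.ab
  rw [D.leibniz, map_add, h1, h2]

/-- bundled bracket -/
def abL {K : Type u} {A : Type v} [Field K] [Ring A] [Algebra K A]
    (D : DoubleBracket K A) : A →ₗ[K] A →ₗ[K] A :=
  D.br.compr₂ (LinearMap.mul' K A)

theorem abL_apply {K : Type u} {A : Type v} [Field K] [Ring A] [Algebra K A]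
    (D : DoubleBracket K A) (x y : A) : abL D x y = D.ab x y := rfl

section tr
variable {K : Type u} {A : Type v} [Field K] [Ring A] [Algebra K A]
  {Q : Type w} [AddCommGroup Q] [Module K Q] (p : A →ₗ[K] Q)
  (hp : ∀ u v : A, p (u * v) = p (v * u))

theorem p_comm (hp : ∀ u v : A, p (u * v) = p (v * u)) (t : A ⊗[K] A) :
    p (LinearMap.mul' K A (TensorProduct.comm K A A t)) = p (LinearMap.mul' K A t) := by
  induction t with
  | zero => simp
  | tmul u v => simp [hp u v]
  | add p q hp hq => simp only [map_add, hp, hq]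

theorem p_anti (hp : ∀ u v : A, p (u * v) = p (v * u)) (D : DoubleBracket K A) (x y : A) :
    p (D.ab x y) = - p (D.ab y x) := by
  unfold DoubleBracket.ab
  rw [D.antisymm y x, map_neg, map_neg, p_comm p hp]

/-- triple multiplication -/
def mm (K : Type u) (A : Type v) [Field K] [Ring A] [Algebra K A] :
    (A ⊗[K] A) ⊗[K] A →ₗ[K] A :=
  (LinearMap.mul' K A).comp (LinearMap.rTensor A (LinearMap.mul' K A))

theorem p_cyc (hp : ∀ u v : A, p (u * v) = p (v * u)) (t : (A ⊗[K] A) ⊗[K] A) :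
    p (mm K A (cyc K A t)) = p (mm K A t) := by
  induction t with
  | zero => simp
  | add p q hp hq => simp only [map_add, hp, hq]
  | tmul s c =>
    induction s with
    | zero => simp
    | add p q hp hq => simp only [map_add, TensorProduct.add_tmul, hp, hq]
    | tmul a b =>
      simp [mm, cyc, mul_assoc]
      rw [hp c, mul_assoc]

/-- the trace of the left triple bracket -/
def MM (p : A →ₗ[K] Q) (D : DoubleBracket K A) (x y z : A) : Q :=
  p (mm K A ((LinearMap.rTensor A (D.br x)) (D.br y z)))

theorem p_expand (hp : ∀ u v : A, p (u * v) = p (v * u)) (D : DoubleBracket K A) (x y z : A) :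
    p (D.ab x (D.ab y z)) = MM p D x y z - MM p D x z y := by
  have key : ∀ t : A ⊗[K] A, p (D.ab x (LinearMap.mul' K A t)) =
      p (mm K A ((LinearMap.rTensor A (D.br x)) t)) +
      p (mm K A ((LinearMap.rTensor A (D.br x)) (TensorProduct.comm K A A t))) := by
    intro t
    induction t with
    | zero => simp [DoubleBracket.ab]
    | add s t hs ht =>
      simp only [← abL_apply, map_add] at hs ht ⊢
      rw [hs, ht]; abel
    | tmul u v =>
      simp only [LinearMap.mul'_apply, ab_mul, map_add, mm, LinearMap.comp_apply,
        LinearMap.rTensor_tmul, TensorProduct.comm_tmul]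
      rw [hp u, add_comm]; rfl
  have h := key (D.br y z)
  unfold MM
  rw [D.antisymm y z, map_neg, map_neg, map_neg, sub_neg_eq_add]
  exact h

theorem p_jac (hp : ∀ u v : A, p (u * v) = p (v * u)) (D : DoubleBracket K A)
    (hD : D.IsPoisson) (x y z : A) :
    p (D.ab x (D.ab y z)) + p (D.ab y (D.ab z x)) + p (D.ab z (D.ab x y)) = 0 := by
  have j : ∀ x y z, MM p D x y z + MM p D y z x + MM p D z x y = 0 := by
    intro x y z
    have h := congrArg (fun t => p (mm K A t)) (hD x y z)
    simp only [map_add, p_cyc p hp, map_zero] at h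
    exact h
  simp only [p_expand p hp]
  have h1 := j x y z
  have h2 := j x z y
  have : (MM p D x y z + MM p D y z x + MM p D z x y)
    - (MM p D x z y + MM p D z y x + MM p D y x z) = 0 := by rw [h1, h2, sub_zero]
  rw [← this]; abel

end tr

theorem ab_w {K : Type u} {A : Type v} [Field K] [Ring A] [Algebra K A]
    (D : DoubleBracket K A) (w : A)
    (hw : ∀ p : A, D.br w p = p ⊗ₜ[K] (1 : A) - (1 : A) ⊗ₜ[K] p)
    (x b : A) (hb : b ∈ wIdeal K w) : D.ab x b ∈ wIdeal K w := by
  have h0 : D.ab x w = 0 := by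
    unfold DoubleBracket.ab
    rw [D.antisymm w x, hw]; simp
  have : wIdeal K w ≤ (wIdeal K w).comap (abL D x) := by
    refine Submodule.span_le.2 ?_
    rintro _ ⟨a, c, rfl⟩
    show abL D x (a * w * c) ∈ wIdeal K w
    rw [abL_apply, ab_mul, ab_mul, h0, mul_zero, zero_add]
    exact add_mem (Submodule.subset_span ⟨_, _, rfl⟩) (Submodule.subset_span ⟨_, _, rfl⟩)
  exact this hb

theorem ab_commSpan {K : Type u} {A : Type v} [Field K] [Ring A] [Algebra K A]
    (D : DoubleBracket K A) (x b : A) (hb : b ∈ commSpan K A) : D.ab x b ∈ commSpan K A := by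
  have : commSpan K A ≤ (commSpan K A).comap (abL D x) := by
    refine Submodule.span_le.2 ?_
    rintro _ ⟨u, v, rfl⟩
    show abL D x (u * v - v * u) ∈ commSpan K A
    rw [map_sub, abL_apply, abL_apply, ab_mul, ab_mul]
    have : u * D.ab x v + D.ab x u * v - (v * D.ab x u + D.ab x v * u)
      = (u * D.ab x v - D.ab x v * u) + (D.ab x u * v - v * D.ab x u) := by abel
    rw [this]
    exact add_mem (Submodule.subset_span ⟨_, _, rfl⟩) (Submodule.subset_span ⟨_, _, rfl⟩)
  exact this hb

theorem map_commSpan {K : Type u} {A : Type v} [Field K] [Ring A] [Algebra K A]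
    {B : Type w} [Ring B] [Algebra K B] (φ : A →ₐ[K] B) (hφ : Function.Surjective φ) :
    (commSpan K A).map φ.toLinearMap = commSpan K B := by
  unfold commSpan
  rw [Submodule.map_span]
  congr 1
  ext z
  constructor
  · rintro ⟨_, ⟨u, v, rfl⟩, rfl⟩
    exact ⟨φ u, φ v, by simp⟩
  · rintro ⟨u, v, rfl⟩
    obtain ⟨u, rfl⟩ := hφ u
    obtain ⟨v, rfl⟩ := hφ v
    exact ⟨_, ⟨u, v, rfl⟩, by simp⟩

/-- Let `(A,⦃-,-⦄)` be a double Poisson algebra with moment map `w`,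
`I = AwA`, and `B = A/I` (presented by a surjective algebra map `φ : A → B` with kernel `I`).
Then: (a) `m⦃x,b⦄ ∈ I` for all `x ∈ A`, `b ∈ I`; (b) there is a unique Lie algebra
structure on `B/[B,B]` making the canonical surjection `A/[A,A] → B/[B,B]` a Lie algebra
morphism; (c) the adjoint action of each class is induced by a `K`-linear derivation of
`B`; i.e. `B` carries an H₀-Poisson (NC Poisson) structure. -/
theorem statement_7 (K : Type u) [Field K] [CharZero K] (A : Type v) [Ring A] [Algebra K A]
    (D : DoubleBracket K A) (hD : D.IsPoisson)
    (w : A) (hw : ∀ p : A, D.br w p = p ⊗ₜ[K] (1 : A) - (1 : A) ⊗ₜ[K] p)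
    (B : Type w) [Ring B] [Algebra K B]
    (φ : A →ₐ[K] B) (hφ : Function.Surjective φ)
    (hker : LinearMap.ker φ.toLinearMap = wIdeal K w) :
    (∀ x b : A, b ∈ wIdeal K w → D.ab x b ∈ wIdeal K w)
    ∧ ∃! L : (B ⧸ commSpan K B) →ₗ[K] (B ⧸ commSpan K B) →ₗ[K] (B ⧸ commSpan K B),
        (∀ x y : A, L ((commSpan K B).mkQ (φ x)) ((commSpan K B).mkQ (φ y))
            = (commSpan K B).mkQ (φ (D.ab x y)))
        ∧ (∀ α β, L α β = - L β α)
        ∧ (∀ α β γ, L α (L β γ) = L (L α β) γ + L β (L α γ))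
        ∧ (∀ b : B, ∃ H : B →ₗ[K] B,
            (∀ u v : B, H (u * v) = H u * v + u * H v)
            ∧ ∀ x : B, L ((commSpan K B).mkQ b) ((commSpan K B).mkQ x)
                = (commSpan K B).mkQ (H x)) := by
  have ha := ab_w D w hw
  refine ⟨ha, ?_⟩
  set p : A →ₗ[K] (B ⧸ commSpan K B) := (commSpan K B).mkQ.comp φ.toLinearMap with hpdef
  have pa : ∀ x, (commSpan K B).mkQ (φ x) = p x := fun x => rfl
  have psurj : Function.Surjective p := (Submodule.mkQ_surjective _).comp hφ
  have hp : ∀ u v : A, p (u * v) = p (v * u) := by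
    intro u v
    rw [← sub_eq_zero, ← map_sub, ← pa, Submodule.mkQ_apply, Submodule.Quotient.mk_eq_zero]
    exact Submodule.subset_span ⟨φ u, φ v, by simp⟩
  have hI : ∀ x, x ∈ wIdeal K w → φ x = 0 := by
    intro x hx
    rw [← hker] at hx
    exact hx
  have hC : ∀ x, x ∈ commSpan K A → p x = 0 := by
    intro x hx
    rw [← pa, Submodule.mkQ_apply, Submodule.Quotient.mk_eq_zero, ← map_commSpan φ hφ]
    exact ⟨x, hx, rfl⟩
  have hk : ∀ y x, p x = 0 → p (D.ab y x) = 0 := by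
    intro y x hx
    rw [← pa, Submodule.mkQ_apply, Submodule.Quotient.mk_eq_zero, ← map_commSpan φ hφ] at hx
    obtain ⟨c, hc, hcx⟩ := hx
    have h1 : x - c ∈ wIdeal K w := by
      rw [← hker, LinearMap.mem_ker, map_sub, hcx]
      exact sub_self _
    have h2 : p (D.ab y (x - c)) = 0 := by
      rw [← pa, hI _ (ha y _ h1), map_zero]
    have h3 := hC _ (ab_commSpan D y c hc)
    rw [← abL_apply] at h2 h3 ⊢
    rw [map_sub, map_sub, h3, sub_zero] at h2
    exact h2
  obtain ⟨s, hs⟩ := p.exists_rightInverse_of_surjective (LinearMap.range_eq_top.2 psurj)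
  have hs' : ∀ q, p (s q) = q := fun q => LinearMap.congr_fun hs q
  have hr : ∀ x y y', p y = p y' → p (D.ab x y) = p (D.ab x y') := by
    intro x y y' h
    have h2 := hk x (y - y') (by rw [map_sub, h, sub_self])
    rw [← abL_apply, map_sub, map_sub, sub_eq_zero] at h2
    exact h2
  have hl : ∀ x x' y, p x = p x' → p (D.ab x y) = p (D.ab x' y) := by
    intro x x' y h
    rw [p_anti p hp D x, p_anti p hp D x', hr y x x' h]
  let L : (B ⧸ commSpan K B) →ₗ[K] (B ⧸ commSpan K B) →ₗ[K] (B ⧸ commSpan K B) :=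
    ((abL D).compr₂ p).compl₁₂ s s
  have hL : ∀ x y, L (p x) (p y) = p (D.ab x y) := by
    intro x y
    show p (D.ab (s (p x)) (s (p y))) = _
    rw [hl _ x _ (hs' _), hr _ _ y (hs' _)]
  refine ⟨L, ⟨hL, ?_, ?_, ?_⟩, ?_⟩
  · intro α β
    obtain ⟨x, rfl⟩ := psurj α
    obtain ⟨y, rfl⟩ := psurj β
    rw [hL, hL, p_anti p hp]
  · intro α β γ
    obtain ⟨x, rfl⟩ := psurj α
    obtain ⟨y, rfl⟩ := psurj β
    obtain ⟨z, rfl⟩ := psurj γ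
    simp only [hL]
    have j := p_jac p hp D hD x y z
    have e1 := p_anti p hp D (D.ab x y) z
    have e2 : p (D.ab y (D.ab x z)) = - p (D.ab y (D.ab z x)) := by
      rw [← hL, p_anti p hp D x z, map_neg, hL]
    rw [e1, e2, ← sub_eq_zero, ← j]; abel
  · intro b
    obtain ⟨a, rfl⟩ := hφ b
    obtain ⟨t, ht⟩ := φ.toLinearMap.exists_rightInverse_of_surjective
      (LinearMap.range_eq_top.2 hφ)
    have ht' : ∀ q, φ (t q) = q := fun q => LinearMap.congr_fun ht q
    let H : B →ₗ[K] B := φ.toLinearMap.comp ((abL D a).comp t)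
    have hH : ∀ y, H (φ y) = φ (D.ab a y) := by
      intro y
      show φ (D.ab a (t (φ y))) = _
      have h1 : t (φ y) - y ∈ wIdeal K w := by
        rw [← hker, LinearMap.mem_ker, map_sub]
        exact sub_eq_zero.2 (ht' _)
      have h2 := hI _ (ha a _ h1)
      rw [← abL_apply, map_sub, map_sub, sub_eq_zero] at h2
      exact h2
    refine ⟨H, ?_, ?_⟩
    · intro u v
      obtain ⟨u, rfl⟩ := hφ u
      obtain ⟨v, rfl⟩ := hφ v
      rw [← map_mul, hH, hH, hH, ab_mul, map_add, map_mul, map_mul, add_comm]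
    · intro x
      obtain ⟨x, rfl⟩ := hφ x
      rw [hH]
      exact hL a x
  · rintro L' ⟨h, -⟩
    refine LinearMap.ext fun α => LinearMap.ext fun β => ?_
    obtain ⟨x, rfl⟩ := psurj α
    obtain ⟨y, rfl⟩ := psurj β
    rw [hL]
    exact h x y
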